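/- Let n ≥ 1, N = 2^n, 0 ≤ g ≤ n − 1, and M ≥ 0. Let G₁, …, G_g be complex N×N Hermitian matrices with G_i² = I, G_i G_j = G_j G_i for all i, j, and trace(∏_{i∈s} G_i) = 0 for every nonempty subset s ⊆ {1,…,g}. Let A₁, …, A_M be complex N×N Hermitian matrices with A_k² = I, A_j A_k = −A_k A_j for all j ≠ k, A_k G_i = G_i A_k for all k, i, and trace(A_k · ∏_{i∈s} G_i) = 0 for every k and every subset s ⊆ {1,…,g} (including s = ∅). Let H := Σ_{s ⊆ {1,…,g}} c_s ∏_{i∈s} G_i + Σ_{k=1}^M Σ_{s ⊆ {1,…,g}} d_{k,s} (∏_{i∈s} G_i) A_k with real coefficients c_s and d_{k,s}. Then for every eigenvalue λ of H, the complex dimension of ker(H − λ·I) is divisible by 2^{n−g−1}. (Degeneracy structure of noncontextual Pauli Hamiltonians: every eigenvalue multiplicity is a multiple of the half-block dimension arising from the anticommuting clique operators.) -/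

import Mathlib

open Matrix BigOperators

section JointEigenprojections

variable {ι R : Type*}

/-- The character of the Boolean group of subsets of `ι` attached to `t`: the sign by which
`∏ i ∈ s, G i` acts on the joint eigenspace where `G i` is `1` for `i ∈ t` and `-1` otherwise. -/
def signChar [DecidableEq ι] (t s : Finset ι) : ℝ := ∏ i ∈ s, if i ∈ t then 1 else -1

lemma exists_joint_eigenprojections_of_commRing [Fintype ι] [DecidableEq ι] [CommRing R]
    [Algebra ℂ R] (G : ι → R) (hsq : ∀ i, G i * G i = 1) :
    ∃ Q : Finset ι → R, ∑ t, Q t = 1 ∧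
      (∀ t s, (∏ i ∈ s, G i) * Q t = (signChar t s : ℂ) • Q t) ∧
      ∀ t, Q t = ((2 : ℂ) ^ Fintype.card ι)⁻¹ • ∑ s, (signChar t s : ℂ) • ∏ i ∈ s, G i := by
  let σ : Finset ι → ι → ℂ := fun t i => if i ∈ t then 1 else -1
  have hσ : ∀ t s, (signChar t s : ℂ) = ∏ i ∈ s, σ t i := fun t s => by
    simp only [signChar, σ]
    push_cast
    exact Finset.prod_congr rfl fun i _ => by split_ifs <;> simp
  let f : Finset ι → ι → R := fun t i => (2 : ℂ)⁻¹ • (1 + σ t i • G i)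
  have hf : ∀ t i, G i * f t i = σ t i • f t i := fun t i => by
    have h : σ t i * σ t i = 1 := by simp only [σ]; split_ifs <;> simp
    rw [smul_comm, smul_add, smul_smul, h, one_smul, mul_smul_comm, mul_add, mul_one,
      mul_smul_comm, hsq, add_comm]
  refine ⟨fun t => ∏ i, f t i, ?_, fun t s => ?_, fun t => ?_⟩
  · have h1 : ∏ i : ι, ((2 : ℂ)⁻¹ • (1 + G i) + (2 : ℂ)⁻¹ • (1 - G i)) = 1 := by
      refine Finset.prod_eq_one fun i _ => ?_
      rw [← smul_add, add_add_sub_cancel, ← two_smul ℂ (1 : R), smul_smul]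
      norm_num
    rw [← h1, Fintype.prod_add]
    refine Finset.sum_congr rfl fun t _ => ?_
    change ∏ i, f t i = _
    rw [← Finset.prod_mul_prod_compl t]
    congr 1 <;> refine Finset.prod_congr rfl fun i hi => ?_
    · simp [f, σ, hi]
    · simp [f, σ, Finset.mem_compl.1 hi, sub_eq_add_neg]
  · change _ * ∏ i, f t i = _ • ∏ i, f t i
    rw [hσ, ← Finset.prod_mul_prod_compl s (f t), ← mul_assoc, ← Finset.prod_mul_distrib,
      Finset.prod_congr rfl fun i _ => hf t i, Finset.prod_smul, smul_mul_assoc]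
  · simp only [f, hσ, Finset.prod_smul, Finset.prod_const, Finset.prod_one_add, inv_pow,
      Finset.card_univ, Finset.powerset_univ]

open scoped IsMulCommutative in
lemma exists_joint_eigenprojections [Fintype ι] [DecidableEq ι] [Ring R] [Algebra ℂ R]
    (G : ι → R) (hsq : ∀ i, G i * G i = 1) (hcomm : ∀ i j, G i * G j = G j * G i) :
    ∃ Q : Finset ι → R, ∑ t, Q t = 1 ∧
      (∀ t (s : Finset ι), s.noncommProd G (fun i _ j _ _ => hcomm i j) * Q t =
        (signChar t s : ℂ) • Q t) ∧
      ∀ t, Q t = ((2 : ℂ) ^ Fintype.card ι)⁻¹ •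
        ∑ s : Finset ι, (signChar t s : ℂ) • s.noncommProd G (fun i _ j _ _ => hcomm i j) := by
  have hS : IsMulCommutative (Algebra.adjoin ℂ (Set.range G)) :=
    Algebra.isMulCommutative_adjoin ℂ (by rintro _ ⟨i, rfl⟩ _ ⟨j, rfl⟩; exact hcomm i j)
  let G' : ι → Algebra.adjoin ℂ (Set.range G) := fun i => ⟨G i, Algebra.subset_adjoin ⟨i, rfl⟩⟩
  have hprod : ∀ s : Finset ι, ((∏ i ∈ s, G' i : Algebra.adjoin ℂ (Set.range G)) : R) =
      s.noncommProd G (fun i _ j _ _ => hcomm i j) := fun s => by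
    rw [← Finset.noncommProd_eq_prod]
    exact Finset.map_noncommProd s G' _ (Algebra.adjoin ℂ (Set.range G)).val
  obtain ⟨Q, h1, h2, h3⟩ := exists_joint_eigenprojections_of_commRing G'
    fun i => Subtype.ext (hsq i)
  refine ⟨fun t => Q t, ?_, fun t s => ?_, fun t => ?_⟩
  · simpa using congrArg (Subtype.val) h1
  · rw [← hprod]
    simpa using congrArg (Subtype.val) (h2 t s)
  · simp only [← hprod]
    simpa using congrArg (Subtype.val) (h3 t)

end JointEigenprojections

lemma sum_smul_mul_self_of_anticommute {κ R : Type*} [Fintype κ] [Ring R] [Algebra ℂ R]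
    (A : κ → R) (hsq : ∀ k, A k * A k = 1) (hanti : ∀ j k, j ≠ k → A j * A k = -(A k * A j))
    (r : κ → ℂ) :
    (∑ k, r k • A k) * (∑ k, r k • A k) = (∑ k, r k * r k) • (1 : R) := by
  classical
  set X := (∑ k, r k • A k) * (∑ k, r k • A k) with hX
  have h1 : X = ∑ j, ∑ k, (r j * r k) • (A j * A k) := by
    simp only [hX, Finset.sum_mul_sum, smul_mul_smul_comm]
  have h2 : X = ∑ j, ∑ k, (r j * r k) • (A k * A j) := by
    rw [h1, Finset.sum_comm]
    simp only [mul_comm]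
  have h3 : X + X = (2 : ℂ) • (∑ k, r k * r k) • (1 : R) := by
    nth_rewrite 1 [h1]
    rw [h2, ← Finset.sum_add_distrib, Finset.sum_smul, Finset.smul_sum]
    refine Finset.sum_congr rfl fun j _ => ?_
    rw [← Finset.sum_add_distrib, Finset.sum_eq_single j]
    · rw [hsq, two_smul]
    · intro k _ hk
      rw [hanti j k hk.symm, smul_neg, neg_add_cancel]
    · simp
  rw [← two_smul ℂ] at h3
  exact smul_right_injective R (two_ne_zero' ℂ) h3

/-- The part, inside the block cut out by `Q`, of the eigenprojection of `K` for the eigenvalue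
zero, when `K` acts on the block as `B - μ` with `B` traceless and `B ^ 2` the scalar `p`. -/
lemma exists_block_kernel_projection {ν : Type*} [Fintype ν] [DecidableEq ν]
    {K Q B : Matrix ν ν ℂ} {μ p : ℂ} {m : ℕ}
    (hK : K * Q = (B - μ • (1 : Matrix ν ν ℂ)) * Q) (hKQ : Commute K Q) (hBQ : Commute B Q)
    (hB : B * B = p • (1 : Matrix ν ν ℂ)) (hp : p = 0 → B = 0)
    (hQtr : Q.trace = 2 * m) (hBtr : (Q * B).trace = 0) :
    ∃ (E L : Matrix ν ν ℂ) (k : ℕ), K * E = 0 ∧ L * K = Q - E ∧ E.trace = (m * k : ℕ) := by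
  have hK' : Q * K = Q * (B - μ • (1 : Matrix ν ν ℂ)) := by
    rw [← hKQ.eq, hK]
    exact ((hBQ.sub_left ((Commute.one_left Q).smul_left μ))).eq
  have hBμ : Commute B (μ • (1 : Matrix ν ν ℂ)) := (Commute.one_right B).smul_right μ
  have hminus : (B + μ • (1 : Matrix ν ν ℂ)) * (B - μ • (1 : Matrix ν ν ℂ)) =
      (p - μ * μ) • (1 : Matrix ν ν ℂ) := by
    rw [← hBμ.mul_self_sub_mul_self_eq, hB, sub_smul, smul_mul_smul_comm, one_mul]
  have hminus' : (B - μ • (1 : Matrix ν ν ℂ)) * (B + μ • (1 : Matrix ν ν ℂ)) =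
      (p - μ * μ) • (1 : Matrix ν ν ℂ) := by
    rw [← hBμ.mul_self_sub_mul_self_eq', hB, sub_smul, smul_mul_smul_comm, one_mul]
  have hplus : Commute (B + μ • (1 : Matrix ν ν ℂ)) Q :=
    hBQ.add_left ((Commute.one_left Q).smul_left μ)
  by_cases h : p = μ * μ
  · by_cases hμ : μ = 0
    · have hB0 : B = 0 := hp (by simp [h, hμ])
      refine ⟨Q, 0, 2, ?_, by simp, ?_⟩
      · rw [hK, hB0, hμ]; simp
      · rw [hQtr]; push_cast; ring
    · refine ⟨(2 * μ)⁻¹ • (Q * (B + μ • (1 : Matrix ν ν ℂ))), -(2 * μ)⁻¹ • Q, 1, ?_, ?_, ?_⟩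
      · rw [← hplus.eq, mul_smul_comm, hplus.eq, ← mul_assoc, hK, mul_assoc, ← hplus.eq,
          ← mul_assoc, hminus', h]
        simp
      · rw [smul_mul_assoc, hK', eq_sub_iff_add_eq, neg_smul, neg_add_eq_sub, ← smul_sub,
          ← mul_sub, add_sub_sub_cancel, ← two_smul ℂ (μ • _), smul_smul, mul_smul_comm, mul_one,
          smul_smul, inv_mul_cancel₀ (by simpa using hμ), one_smul]
      · rw [mul_add, trace_smul, trace_add, hBtr, mul_smul_comm, mul_one, trace_smul, hQtr]
        simp only [smul_eq_mul]
        push_cast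
        field_simp
        ring
  · have hne : p - μ * μ ≠ 0 := sub_ne_zero.2 h
    refine ⟨0, (p - μ * μ)⁻¹ • ((B + μ • (1 : Matrix ν ν ℂ)) * Q), 0, by simp, ?_, by simp⟩
    rw [smul_mul_assoc, mul_assoc, hK', ← mul_assoc, hplus.eq, mul_assoc, hminus, mul_smul_comm,
      smul_smul, inv_mul_cancel₀ hne, one_smul, mul_one, sub_zero]

lemma finrank_ker_eq_trace {ν : Type*} [Fintype ν] [DecidableEq ν] {K E L : Matrix ν ν ℂ}
    (hKE : K * E = 0) (hLK : L * K = 1 - E) :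
    (Module.finrank ℂ (LinearMap.ker K.mulVecLin) : ℂ) = E.trace := by
  have h : LinearMap.IsProj (LinearMap.ker K.mulVecLin) (Matrix.toLin' E) := by
    refine ⟨fun x => ?_, fun x hx => ?_⟩
    · simp [hKE]
    · have hx' : K *ᵥ x = 0 := hx
      have := congrArg (· *ᵥ x) hLK
      simp only [← mulVec_mulVec, hx', mulVec_zero, sub_mulVec, one_mulVec] at this
      simpa using (sub_eq_zero.1 this.symm).symm
  rw [← h.trace, Matrix.trace_toLin'_eq]

/-- Degeneracy structure of noncontextual Pauli Hamiltonians: for a noncontextual Pauli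
Hamiltonian `H` on `n` qubits generated (under the Jordan product) by `g ≤ n - 1`
independent commuting Hermitian symmetry generators `G i` and pairwise anticommuting
Hermitian clique representatives `A k` commuting with all `G i` (all nontrivial products
being traceless), the multiplicity of every eigenvalue `λ` of `H` — the complex dimension
of `ker (H - λ • 1)` — is divisible by `2 ^ (n - g - 1)`. -/
theorem noncontextual_eigenvalue_multiplicity {n g M : ℕ} (hn : 1 ≤ n) (hg : g ≤ n - 1)
    (G : Fin g → Matrix (Fin (2 ^ n)) (Fin (2 ^ n)) ℂ)
    (A : Fin M → Matrix (Fin (2 ^ n)) (Fin (2 ^ n)) ℂ)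
    (hGherm : ∀ i, (G i).IsHermitian)
    (hGsq : ∀ i, G i * G i = 1)
    (hGcomm : ∀ i j, G i * G j = G j * G i)
    (hGtr : ∀ s : Finset (Fin g), s.Nonempty →
      (s.noncommProd G (fun i _ j _ _ => hGcomm i j)).trace = 0)
    (hAherm : ∀ k, (A k).IsHermitian)
    (hAsq : ∀ k, A k * A k = 1)
    (hAanti : ∀ j k, j ≠ k → A j * A k = -(A k * A j))
    (hAG : ∀ k i, A k * G i = G i * A k)
    (hAGtr : ∀ k, ∀ s : Finset (Fin g),
      (s.noncommProd G (fun i _ j _ _ => hGcomm i j) * A k).trace = 0)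
    (c : Finset (Fin g) → ℝ) (d : Fin M → Finset (Fin g) → ℝ)
    (H : Matrix (Fin (2 ^ n)) (Fin (2 ^ n)) ℂ)
    (hH : H = (∑ s : Finset (Fin g), (c s : ℂ) • s.noncommProd G (fun i _ j _ _ => hGcomm i j))
        + ∑ k : Fin M, ∑ s : Finset (Fin g),
            (d k s : ℂ) • (s.noncommProd G (fun i _ j _ _ => hGcomm i j) * A k)) :
    ∀ lam : ℂ, lam ∈ spectrum ℂ H →
      2 ^ (n - g - 1) ∣
        Module.finrank ℂ
          ↥(LinearMap.ker (H - lam • (1 : Matrix (Fin (2 ^ n)) (Fin (2 ^ n)) ℂ)).mulVecLin) := by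
  intro lam _
  set m := 2 ^ (n - g - 1) with hm
  set P : Finset (Fin g) → Matrix (Fin (2 ^ n)) (Fin (2 ^ n)) ℂ :=
    fun s => s.noncommProd G (fun i _ j _ _ => hGcomm i j) with hP
  have hdim : (2 : ℂ) ^ n = 2 ^ g * (2 * m) := by
    rw [hm]
    push_cast
    rw [← pow_succ', ← pow_add]
    congr 1
    omega
  have hcommP : ∀ X : Matrix (Fin (2 ^ n)) (Fin (2 ^ n)) ℂ, (∀ i, Commute X (G i)) →
      ∀ s, Commute X (P s) := fun X hX s =>
    Finset.noncommProd_commute _ _ _ _ fun i _ => hX i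
  obtain ⟨Q, hQ1, hQP, hQ⟩ := exists_joint_eigenprojections G hGsq hGcomm
  replace hQP : ∀ t s, P s * Q t = (signChar t s : ℂ) • Q t := hQP
  replace hQ : ∀ t, Q t = ((2 : ℂ) ^ Fintype.card (Fin g))⁻¹ • ∑ s, (signChar t s : ℂ) • P s := hQ
  rw [Fintype.card_fin] at hQ
  have hcommQ : ∀ X : Matrix (Fin (2 ^ n)) (Fin (2 ^ n)) ℂ, (∀ i, Commute X (G i)) →
      ∀ t, Commute X (Q t) := fun X hX t => by
    rw [hQ]
    exact (Commute.sum_right _ _ _ fun s _ => (hcommP X hX s).smul_right _).smul_right _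
  have hAQ : ∀ k t, Commute (A k) (Q t) := fun k => hcommQ _ (hAG k)
  have hPQ : ∀ s t, Commute (P s) (Q t) := fun s =>
    hcommQ _ fun i => (hcommP (G i) (fun j => hGcomm i j) s).symm
  have hP0 : P ∅ = 1 := Finset.noncommProd_empty _ _
  have hQtr : ∀ t, (Q t).trace = 2 * m := fun t => by
    rw [hQ, trace_smul, trace_sum, Finset.sum_eq_single ∅]
    · simp only [signChar, Finset.prod_empty, hP0, trace_smul, trace_one, Fintype.card_fin,
        smul_eq_mul]
      push_cast
      rw [hdim]
      field_simp
    · intro s _ hs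
      rw [trace_smul, hGtr s (Finset.nonempty_iff_ne_empty.2 hs), smul_zero]
    · simp
  have hQAtr : ∀ t k, (Q t * A k).trace = 0 := fun t k => by
    rw [hQ, smul_mul_assoc, trace_smul, Finset.sum_mul, trace_sum, Finset.sum_eq_zero, smul_zero]
    intro s _
    rw [smul_mul_assoc, trace_smul, hAGtr, smul_zero]
  have hblock : ∀ t, ∃ (E L : Matrix (Fin (2 ^ n)) (Fin (2 ^ n)) ℂ) (k : ℕ),
      (H - lam • (1 : Matrix (Fin (2 ^ n)) (Fin (2 ^ n)) ℂ)) * E = 0 ∧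
      L * (H - lam • (1 : Matrix (Fin (2 ^ n)) (Fin (2 ^ n)) ℂ)) = Q t - E ∧
      E.trace = (m * k : ℕ) := fun t => by
    let r : Fin M → ℝ := fun k => ∑ s, d k s * signChar t s
    let a : ℂ := ∑ s, (c s : ℂ) * signChar t s
    have hHQ : Commute H (Q t) := by
      rw [hH]
      refine (Commute.sum_left _ _ _ fun s _ => (hPQ s t).smul_left _).add_left ?_
      exact Commute.sum_left _ _ _ fun k _ => Commute.sum_left _ _ _ fun s _ =>
        ((hPQ s t).mul_left (hAQ k t)).smul_left _
    have hPAQ : ∀ k s, P s * A k * Q t = (signChar t s : ℂ) • (A k * Q t) := fun k s => by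
      rw [mul_assoc, (hAQ k t).eq, ← mul_assoc, hQP, smul_mul_assoc]
    refine exists_block_kernel_projection (B := ∑ k, (r k : ℂ) • A k) (μ := lam - a)
      (p := ∑ k, (r k : ℂ) * r k) ?_ (hHQ.sub_left ((Commute.one_left _).smul_left _))
      (Commute.sum_left _ _ _ fun k _ => (hAQ k t).smul_left _)
      (sum_smul_mul_self_of_anticommute A hAsq hAanti _) ?_ (hQtr t) ?_
    · have hHt : H * Q t = a • Q t + (∑ k, (r k : ℂ) • A k) * Q t := by
        rw [hH, add_mul, Finset.sum_mul, Finset.sum_mul, Finset.sum_mul]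
        congr 1
        · rw [Finset.sum_smul]
          refine Finset.sum_congr rfl fun s _ => ?_
          rw [smul_mul_assoc, mul_smul, ← hQP]
        · refine Finset.sum_congr rfl fun k _ => ?_
          rw [Finset.sum_mul, smul_mul_assoc]
          simp only [r]
          push_cast
          rw [Finset.sum_smul]
          refine Finset.sum_congr rfl fun s _ => ?_
          rw [smul_mul_assoc, mul_smul, ← hPAQ]
      rw [sub_mul, sub_mul, hHt, smul_mul_assoc, smul_mul_assoc, one_mul, sub_smul]
      abel
    · intro hr
      have hr' : ∑ k, r k * r k = 0 := by exact_mod_cast hr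
      rw [Finset.sum_eq_zero_iff_of_nonneg fun k _ => mul_self_nonneg _] at hr'
      refine Finset.sum_eq_zero fun k hk => ?_
      rw [mul_self_eq_zero.1 (hr' k hk)]
      simp
    · rw [Finset.mul_sum, trace_sum]
      refine Finset.sum_eq_zero fun k _ => ?_
      rw [mul_smul_comm, trace_smul, hQAtr, smul_zero]
  choose E L k hE hL hk using hblock
  have htr := finrank_ker_eq_trace (E := ∑ t, E t) (L := ∑ t, L t)
    (by rw [Finset.mul_sum, Finset.sum_eq_zero fun t _ => hE t])
    (by rw [Finset.sum_mul, Finset.sum_congr rfl fun t _ => hL t, Finset.sum_sub_distrib, hQ1])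
  rw [trace_sum, Finset.sum_congr rfl fun t _ => hk t, ← Nat.cast_sum, Nat.cast_inj,
    ← Finset.mul_sum] at htr
  exact ⟨_, htr⟩
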